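/- arXiv:1904.12001 — 2 statements merged into one kernel-verified Lean document; each statement's English description precedes it below -/
import Mathlib

section
/- Let N ≥ 2 and let u be a C² solution of the radial Pucci equation θ(r) u''(r) + ((N−1)/r) Θ(r) u'(r) + g(u(r)) = 0 on an interval I ⊂ (0,+∞) with u' < 0 on I. Then E_λ is decreasing on every subinterval of I on which g(u(r)) > 0, and E_Λ is decreasing on every subinterval of I on which g(u(r)) < 0. -/
open Set Filter Topology

/-- If `u' < 0` on `[a, b]` and `c u'' + g(u) > 0` on `(a, b)`, then the energy
`c / 2 * u' ^ 2 + G(u)` is strictly smaller at `b` than at `a`, for any primitive `G` of `g`. -/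
theorem energy_lt_of_deriv_neg {a b c : ℝ} {g G u : ℝ → ℝ} (hab : a < b)
    (hG : ∀ t, HasDerivAt G (g t) t) (hu : ContDiffOn ℝ 2 u (Icc a b))
    (hu' : ∀ r ∈ Icc a b, deriv u r < 0)
    (hpos : ∀ r ∈ Ioo a b, 0 < c * deriv (deriv u) r + g (u r)) :
    c / 2 * (deriv u b) ^ 2 + G (u b) < c / 2 * (deriv u a) ^ 2 + G (u a) := by
  have hdiff : ∀ r ∈ Icc a b, DifferentiableAt ℝ u r := fun r hr ↦
    differentiableAt_of_deriv_ne_zero (hu' r hr).ne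
  have hU : UniqueDiffOn ℝ (Icc a b) := uniqueDiffOn_Icc hab
  have hu1 : ContDiffOn ℝ 1 (deriv u) (Icc a b) :=
    (hu.derivWithin hU (by norm_num)).congr fun r hr ↦ ((hdiff r hr).derivWithin (hU r hr)).symm
  have hGc : Continuous G := continuous_iff_continuousAt.2 fun t ↦ (hG t).continuousAt
  have hanti : StrictAntiOn (fun r ↦ c / 2 * (deriv u r) ^ 2 + G (u r)) (Icc a b) := by
    apply strictAntiOn_of_deriv_neg (convex_Icc a b)
    · exact (continuousOn_const.mul (hu1.continuousOn.pow 2)).add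
        (hGc.comp_continuousOn hu.continuousOn)
    · intro r hr
      rw [interior_Icc] at hr
      have hrI := Ioo_subset_Icc_self hr
      have h1 := (hdiff r hrI).hasDerivAt
      have h2 : HasDerivAt (deriv u) (deriv (deriv u) r) r :=
        ((hu1.differentiableOn one_ne_zero).differentiableAt
          (Icc_mem_nhds hr.1 hr.2)).hasDerivAt
      have hE := ((h2.pow 2).const_mul (c / 2)).add ((hG (u r)).comp r h1)
      have hval := hE.deriv
      simp only [Pi.add_def, Function.comp_def, Pi.pow_apply] at hval
      rw [hval]
      have := mul_neg_of_neg_of_pos (hu' r hrI) (hpos r hr)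
      norm_num
      linarith
  exact hanti (left_mem_Icc.2 hab.le) (right_mem_Icc.2 hab.le) hab

theorem pucci_radial_energy_decreasing_of_deriv_neg
    (lam Lam : ℝ) (hlam : 0 < lam) (hlamLam : lam ≤ Lam)
    (N : ℕ) (hN : 2 ≤ N)
    (g : ℝ → ℝ) (hg1 : LocallyLipschitz g)
    (hg2 : ∀ t, g (-t) = - g t)
    (α : ℝ) (hα : 0 < α)
    (hg3pos : ∀ t, 0 < t → t < α → 0 < g t)
    (hg3neg : ∀ t, α < t → g t < 0)
    (G : ℝ → ℝ) (hG : ∀ t, G t = ∫ s in (0:ℝ)..t, g s)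
    (I : Set ℝ) (hI : I ⊆ Set.Ioi 0) (hIconn : I.OrdConnected)
    (u : ℝ → ℝ) (hu : ContDiffOn ℝ 2 u I)
    (hode : ∀ r ∈ I,
      (if 0 ≤ deriv (deriv u) r then Lam else lam) * deriv (deriv u) r
        + ((N : ℝ) - 1) / r * ((if 0 ≤ deriv u r then Lam else lam) * deriv u r)
        + g (u r) = 0)
    (hu' : ∀ r ∈ I, deriv u r < 0) :
    (∀ J : Set ℝ, J ⊆ I → J.OrdConnected → (∀ r ∈ J, 0 < g (u r)) →
      StrictAntiOn (fun r => lam / 2 * (deriv u r) ^ 2 + G (u r)) J) ∧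
    (∀ J : Set ℝ, J ⊆ I → J.OrdConnected → (∀ r ∈ J, g (u r) < 0) →
      StrictAntiOn (fun r => Lam / 2 * (deriv u r) ^ 2 + G (u r)) J) := by
  have hGd : ∀ t, HasDerivAt G (g t) t := by
    intro t
    have hc := hg1.continuous
    rw [show G = fun t ↦ ∫ s in (0:ℝ)..t, g s from funext hG]
    exact intervalIntegral.integral_hasDerivAt_right (hc.intervalIntegrable 0 t)
      (hc.stronglyMeasurableAtFilter _ _) hc.continuousAt
  have hdrift : ∀ r ∈ I, ((N : ℝ) - 1) / r * (lam * deriv u r) < 0 := by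
    intro r hr
    have hN1 : (0 : ℝ) < (N : ℝ) - 1 := by
      have : (2 : ℝ) ≤ N := by exact_mod_cast hN
      linarith
    exact mul_neg_of_pos_of_neg (div_pos hN1 (hI hr))
      (mul_neg_of_pos_of_neg hlam (hu' r hr))
  constructor
  · intro J hJI hJ hg a ha b hb hab
    have hsub : Icc a b ⊆ J := hJ.out ha hb
    refine energy_lt_of_deriv_neg hab hGd (hu.mono (hsub.trans hJI))
      (fun r hr ↦ hu' r (hJI (hsub hr))) fun r hr ↦ ?_
    have hrJ := hsub (Ioo_subset_Icc_self hr)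
    have hode_r := hode r (hJI hrJ)
    have hdrift_r := hdrift r (hJI hrJ)
    have hg_r := hg r hrJ
    rw [if_neg (hu' r (hJI hrJ)).not_ge] at hode_r
    split_ifs at hode_r with h
    · positivity
    · linarith
  · intro J hJI hJ hg a ha b hb hab
    have hsub : Icc a b ⊆ J := hJ.out ha hb
    refine energy_lt_of_deriv_neg hab hGd (hu.mono (hsub.trans hJI))
      (fun r hr ↦ hu' r (hJI (hsub hr))) fun r hr ↦ ?_
    have hrJ := hsub (Ioo_subset_Icc_self hr)
    have hode_r := hode r (hJI hrJ)
    have hdrift_r := hdrift r (hJI hrJ)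
    have hg_r := hg r hrJ
    rw [if_neg (hu' r (hJI hrJ)).not_ge] at hode_r
    split_ifs at hode_r with h
    · linarith
    · have := mul_neg_of_pos_of_neg hlam (not_le.1 h)
      linarith
end

section
/- Let ξ ∈ ℝ with |ξ| > α, and let u ∈ C²([0,R)) with u(0) = ξ and u'(0) = 0 be the solution of the radial Pucci equation for M⁺ on its maximal interval of existence [0,R). Then |u| is strictly increasing on (0,R) and |u(r)| → +∞ as r → R⁻. -/
open Set Filter Topology

/-- The piecewise linear function `x ↦ A x` for `x ≥ 0`, `x ↦ B x` for `x < 0`. -/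
noncomputable def pucciFun (A B x : ℝ) : ℝ := (if 0 ≤ x then A else B) * x

theorem pucciFun_eq (A B x : ℝ) : pucciFun A B x = A * max x 0 + B * min x 0 := by
  unfold pucciFun
  split_ifs with h
  · simp [h]
  · push Not at h
    simp [h.le]

theorem pucciFun_of_nonneg {A B x : ℝ} (hx : 0 ≤ x) : pucciFun A B x = A * x := by
  simp [pucciFun, hx]

theorem pucciFun_neg (A B x : ℝ) : pucciFun A B (-x) = -pucciFun B A x := by
  rcases lt_trichotomy x 0 with h | rfl | h
  · simp [pucciFun, h.le, h]
  · simp [pucciFun]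
  · simp [pucciFun, h, h.le]

theorem continuous_pucciFun (A B : ℝ) : Continuous (pucciFun A B) := by
  simp_rw [funext (pucciFun_eq A B)]
  fun_prop

theorem abs_pucciFun_sub_le (A B x y : ℝ) :
    |pucciFun A B x - pucciFun A B y| ≤ (|A| + |B|) * |x - y| := by
  have h : pucciFun A B x - pucciFun A B y
      = A * (max x 0 - max y 0) + B * (min x 0 - min y 0) := by
    rw [pucciFun_eq, pucciFun_eq]; ring
  have h1 : |max x 0 - max y 0| ≤ |x - y| := abs_max_sub_max_le_abs x y 0
  have h2 : |min x 0 - min y 0| ≤ |x - y| := by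
    simpa using abs_min_sub_min_le_max x 0 y 0
  rw [h, add_mul]
  refine (abs_add_le _ _).trans ?_
  rw [abs_mul, abs_mul]
  gcongr

theorem monotone_pucciFun {A B : ℝ} (hA : 0 ≤ A) (hB : 0 ≤ B) : Monotone (pucciFun A B) := by
  intro x y h
  rw [pucciFun_eq, pucciFun_eq]
  gcongr

theorem pucciFun_mul {A B t : ℝ} (ht : 0 < t) (x : ℝ) :
    pucciFun A B (t * x) = t * pucciFun A B x := by
  simp only [pucciFun, mul_nonneg_iff_of_pos_left ht]
  ring

theorem pucciFun_pucciFun_inv {A B : ℝ} (hA : 0 < A) (hB : 0 < B) (x : ℝ) :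
    pucciFun A B (pucciFun A⁻¹ B⁻¹ x) = x := by
  by_cases h : 0 ≤ x
  · have : 0 ≤ A⁻¹ * x := by positivity
    rw [pucciFun_of_nonneg h, pucciFun_of_nonneg this]
    field_simp
  · have h' : ¬ 0 ≤ B⁻¹ * x := by
      rw [mul_nonneg_iff_of_pos_left (inv_pos.2 hB)]; exact h
    simp only [pucciFun, h, if_false, h']
    field_simp

theorem pucciFun_inv_pucciFun {A B : ℝ} (hA : 0 < A) (hB : 0 < B) (x : ℝ) :
    pucciFun A⁻¹ B⁻¹ (pucciFun A B x) = x := by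
  simpa using pucciFun_pucciFun_inv (inv_pos.2 hA) (inv_pos.2 hB) x

section Growth

variable {A B k T : ℝ} {g v v₁ v₂ : ℝ → ℝ}

/-- The equation forces `v'(0) = 0`, and passes to the limit at the origin. -/
theorem radial_pucci_at_zero (hT : 0 < T) (hk : 0 < k) (hA : 0 < A) (hB : 0 < B)
    (hg : Continuous g)
    (hv : ∀ r ∈ Icc 0 T, HasDerivWithinAt v (v₁ r) (Icc 0 T) r)
    (hv₁ : ∀ r ∈ Icc 0 T, HasDerivWithinAt v₁ (v₂ r) (Icc 0 T) r)
    (hv₂ : ContinuousOn v₂ (Icc 0 T))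
    (hode : ∀ r ∈ Ioc 0 T, pucciFun A B (v₂ r) + k / r * pucciFun A B (v₁ r) + g (v r) = 0) :
    v₁ 0 = 0 ∧ (1 + k) * pucciFun A B (v₂ 0) + g (v 0) = 0 := by
  have h0 : (0 : ℝ) ∈ Icc 0 T := ⟨le_rfl, hT.le⟩
  have hle : 𝓝[>] (0 : ℝ) ≤ 𝓝[Icc 0 T] 0 := by
    rw [← nhdsWithin_Ioc_eq_nhdsGT hT]
    exact nhdsWithin_mono _ Ioc_subset_Icc_self
  have cv : Tendsto v (𝓝[>] 0) (𝓝 (v 0)) := (hv 0 h0).continuousWithinAt.mono_left hle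
  have cv₁ : Tendsto v₁ (𝓝[>] 0) (𝓝 (v₁ 0)) := (hv₁ 0 h0).continuousWithinAt.mono_left hle
  have cv₂ : Tendsto v₂ (𝓝[>] 0) (𝓝 (v₂ 0)) := (hv₂ 0 h0).mono_left hle
  have cp := continuous_pucciFun A B
  have cr : Tendsto (fun r : ℝ => r) (𝓝[>] 0) (𝓝 0) := tendsto_nhdsWithin_of_tendsto_nhds tendsto_id
  have hev : ∀ᶠ r in 𝓝[>] (0 : ℝ), r ∈ Ioc 0 T := Ioc_mem_nhdsGT hT
  have hz : v₁ 0 = 0 := by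
    have t1 : Tendsto (fun r => r * pucciFun A B (v₂ r) + k * pucciFun A B (v₁ r) + r * g (v r))
        (𝓝[>] 0) (𝓝 (0 * pucciFun A B (v₂ 0) + k * pucciFun A B (v₁ 0) + 0 * g (v 0))) :=
      ((cr.mul ((cp.tendsto _).comp cv₂)).add (((cp.tendsto _).comp cv₁).const_mul k)).add
        (cr.mul ((hg.tendsto _).comp cv))
    have t2 : Tendsto (fun r => r * pucciFun A B (v₂ r) + k * pucciFun A B (v₁ r) + r * g (v r))
        (𝓝[>] 0) (𝓝 0) := by
      refine tendsto_const_nhds.congr' ?_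
      filter_upwards [hev] with r hr
      have := hode r hr
      have hr0 : r ≠ 0 := hr.1.ne'
      field_simp at this
      linarith
    have := tendsto_nhds_unique t1 t2
    have h3 : pucciFun A B (v₁ 0) = 0 := by
      have : k * pucciFun A B (v₁ 0) = 0 := by linarith
      exact (mul_eq_zero.1 this).resolve_left hk.ne'
    have h4 := pucciFun_inv_pucciFun hA hB (v₁ 0)
    rw [h3] at h4
    simpa [pucciFun] using h4.symm
  refine ⟨hz, ?_⟩
  have hs : Tendsto (fun r => r⁻¹ * v₁ r) (𝓝[>] 0) (𝓝 (v₂ 0)) := by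
    have := ((hasDerivWithinAt_iff_tendsto_slope.1 (hv₁ 0 h0)).mono_left
      (show 𝓝[Ioc 0 T] (0 : ℝ) ≤ _ from nhdsWithin_mono _ fun x hx =>
        ⟨Ioc_subset_Icc_self hx, hx.1.ne'⟩))
    rw [nhdsWithin_Ioc_eq_nhdsGT hT] at this
    refine this.congr fun r => ?_
    simp [slope, hz]
  have t1 : Tendsto (fun r => pucciFun A B (v₂ r) + k * pucciFun A B (r⁻¹ * v₁ r) + g (v r))
      (𝓝[>] 0) (𝓝 (pucciFun A B (v₂ 0) + k * pucciFun A B (v₂ 0) + g (v 0))) :=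
    (((cp.tendsto _).comp cv₂).add (((cp.tendsto _).comp hs).const_mul k)).add
      ((hg.tendsto _).comp cv)
  have t2 : Tendsto (fun r => pucciFun A B (v₂ r) + k * pucciFun A B (r⁻¹ * v₁ r) + g (v r))
      (𝓝[>] 0) (𝓝 0) := by
    refine tendsto_const_nhds.congr' ?_
    filter_upwards [hev] with r hr
    rw [pucciFun_mul (inv_pos.2 hr.1), ← hode r hr]
    ring
  have := tendsto_nhds_unique t1 t2
  linarith

theorem radial_pucci_linear_growth {c δ M : ℝ} (hT : 0 < T) (hk : 0 < k) (hA : 0 < A) (hB : 0 < B)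
    (hg : Continuous g)
    (hv : ∀ r ∈ Icc 0 T, HasDerivWithinAt v (v₁ r) (Icc 0 T) r)
    (hv₁ : ∀ r ∈ Icc 0 T, HasDerivWithinAt v₁ (v₂ r) (Icc 0 T) r)
    (hv₂ : ContinuousOn v₂ (Icc 0 T))
    (hode : ∀ r ∈ Ioc 0 T, pucciFun A B (v₂ r) + k / r * pucciFun A B (v₁ r) + g (v r) = 0)
    (hδ : 0 < δ) (hδc : (1 + k) * A * δ < c) (hM : ∀ r ∈ Icc 0 T, v r ≤ M)
    (hc : ∀ t ∈ Icc (v 0) M, g t ≤ -c) :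
    ∀ r ∈ Icc 0 T, v 0 ≤ v r ∧ δ * r ≤ v₁ r := by
  obtain ⟨hz, hz2⟩ := radial_pucci_at_zero hT hk hA hB hg hv hv₁ hv₂ hode
  have cv : ContinuousOn v (Icc 0 T) := fun r hr => (hv r hr).continuousWithinAt
  have cv₁ : ContinuousOn v₁ (Icc 0 T) := fun r hr => (hv₁ r hr).continuousWithinAt
  have hmono := monotone_pucciFun hA.le hB.le
  have key : ∀ s ∈ Ico 0 T, v 0 ≤ v s → δ * s = v₁ s → δ < v₂ s := by
    intro s hs h1 h2
    have hgs := hc (v s) ⟨h1, hM s ⟨hs.1, hs.2.le⟩⟩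
    refine hmono.reflect_lt ?_
    rw [pucciFun_of_nonneg hδ.le]
    rcases hs.1.eq_or_lt with rfl | h0
    · have : (1 + k) * (A * δ) < (1 + k) * pucciFun A B (v₂ 0) := by linarith
      exact lt_of_mul_lt_mul_left this (by linarith)
    · have := hode s ⟨h0, hs.2.le⟩
      rw [← h2, pucciFun_of_nonneg (mul_pos hδ h0).le] at this
      have e : k / s * (A * (δ * s)) = k * A * δ := by field_simp
      rw [e] at this
      linarith
  have hcl : IsClosed ({r | v 0 ≤ v r ∧ δ * r ≤ v₁ r} ∩ Icc 0 T) := by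
    have h1 := cv.preimage_isClosed_of_isClosed isClosed_Icc (isClosed_Ici (a := v 0))
    have h2 := (cv₁.sub (continuousOn_const.mul continuousOn_id :
      ContinuousOn (fun r : ℝ => δ * id r) (Icc 0 T))).preimage_isClosed_of_isClosed isClosed_Icc
        (isClosed_Ici (a := (0 : ℝ)))
    convert h1.inter h2 using 1
    ext r
    have : (0 ≤ (v₁ - fun r => δ * id r) r) ↔ δ * r ≤ v₁ r := by simp
    simp only [mem_inter_iff, mem_ofPred_eq, mem_preimage, mem_Ici] at this ⊢
    tauto
  refine hcl.Icc_subset_of_forall_exists_gt ⟨le_rfl, by simp [hz]⟩ ?_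
  rintro x ⟨⟨hx1, hx2⟩, hx⟩ y hy
  have hxI : x ∈ Icc 0 T := ⟨hx.1, hx.2.le⟩
  have hleT : 𝓝[>] x ≤ 𝓝[Icc 0 T] x := by
    rw [← nhdsWithin_Ioc_eq_nhdsGT hx.2]
    exact nhdsWithin_mono _ fun z hz => ⟨hx.1.trans hz.1.le, hz.2⟩
  have hev : ∀ᶠ z in 𝓝[>] x, δ * z < v₁ z := by
    rcases hx2.eq_or_lt with h | h
    · have hk := key x hx hx1 h
      have hs := (hasDerivWithinAt_iff_tendsto_slope.1 (hv₁ x hxI)).mono_left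
        (show 𝓝[Ioc x T] x ≤ _ from nhdsWithin_mono _ fun z hz =>
          ⟨⟨hx.1.trans hz.1.le, hz.2⟩, hz.1.ne'⟩)
      rw [nhdsWithin_Ioc_eq_nhdsGT hx.2] at hs
      filter_upwards [hs.eventually (lt_mem_nhds hk), self_mem_nhdsWithin] with z hz hxz
      rw [slope_def_field, lt_div_iff₀ (sub_pos.2 hxz)] at hz
      linarith
    · have hc1 : Tendsto (fun z => v₁ z - δ * z) (𝓝[>] x) (𝓝 (v₁ x - δ * x)) :=
        ((cv₁ x hxI).mono_left hleT).sub
          (tendsto_nhdsWithin_of_tendsto_nhds ((continuous_const.mul continuous_id).tendsto x))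
      filter_upwards [hc1.eventually (lt_mem_nhds (sub_pos.2 h))] with z hz
      linarith
  obtain ⟨w, hw, hwS⟩ := (mem_nhdsGT_iff_exists_Ioc_subset).1 hev
  set z := min w (min y T) with hzdef
  have hxz : x < z := lt_min hw (lt_min hy hx.2)
  have hzT : z ≤ T := (min_le_right _ _).trans (min_le_right _ _)
  refine ⟨z, ⟨?_, (hwS ⟨hxz, min_le_left _ _⟩).le⟩, hxz, (min_le_right _ _).trans (min_le_left _ _)⟩
  have hsub : Icc x z ⊆ Icc 0 T := fun q hq => ⟨hx.1.trans hq.1, hq.2.trans hzT⟩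
  have hm : MonotoneOn v (Icc x z) := by
    refine monotoneOn_of_hasDerivWithinAt_nonneg (convex_Icc _ _) (cv.mono hsub)
      (f' := v₁) (fun q hq => (hv q (hsub (interior_subset hq))).mono
        (interior_subset.trans hsub)) fun q hq => ?_
    rw [interior_Icc] at hq
    have : δ * q < v₁ q := hwS ⟨hq.1, hq.2.le.trans (min_le_left _ _)⟩
    have h0 : 0 < q := hx.1.trans_lt hq.1
    exact (mul_pos hδ h0).le.trans this.le
  exact hx1.trans (hm ⟨le_rfl, hxz.le⟩ ⟨hxz.le, le_rfl⟩ hxz.le)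

end Growth

section Extension

/-- The vector field of the first order system equivalent to the radial equation. -/
noncomputable def pucciField (A B k : ℝ) (g : ℝ → ℝ) (t : ℝ) (z : ℝ × ℝ) : ℝ × ℝ :=
  (z.2, pucciFun A⁻¹ B⁻¹ (-g z.1 - k / t * pucciFun A B z.2))

variable {A B k : ℝ} {g : ℝ → ℝ}

theorem continuousOn_pucciField (hg : Continuous g) :
    ContinuousOn (fun q : ℝ × ℝ × ℝ => pucciField A B k g q.1 q.2) {q | 0 < q.1} := by
  have hp := continuous_pucciFun A B
  have hq := continuous_pucciFun A⁻¹ B⁻¹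
  refine ContinuousOn.prodMk (by fun_prop) (hq.comp_continuousOn ?_)
  refine ContinuousOn.sub (by fun_prop) (ContinuousOn.mul ?_ (by fun_prop))
  exact continuousOn_const.div (by fun_prop) fun q hq => (ne_of_gt hq)

theorem pucciField_eq {t x y w : ℝ} (hA : 0 < A) (hB : 0 < B)
    (h : pucciFun A B w + k / t * pucciFun A B y + g x = 0) :
    pucciField A B k g t (x, y) = (y, w) := by
  have : -g x - k / t * pucciFun A B y = pucciFun A B w := by linarith
  simp [pucciField, this, pucciFun_inv_pucciFun hA hB]

theorem pucciField_solves (hA : 0 < A) (hB : 0 < B) (t : ℝ) (z : ℝ × ℝ) :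
    pucciFun A B (pucciField A B k g t z).2 + k / t * pucciFun A B z.2 + g z.1 = 0 := by
  simp only [pucciField]
  rw [pucciFun_pucciFun_inv hA hB]
  ring

theorem exists_lipschitzOnWith_pucciField (hg : LocallyLipschitz g) {R : ℝ} (hR : 0 < R)
    (z₀ : ℝ × ℝ) (a : ℝ) : ∃ K : NNReal, ∀ t, R ≤ t →
      LipschitzOnWith K (pucciField A B k g t) (Metric.closedBall z₀ a) := by
  obtain ⟨Kg, hKg⟩ := (hg.locallyLipschitzOn (s := Metric.closedBall z₀.1 a)
    ).exists_lipschitzOnWith_of_compact (isCompact_closedBall _ _)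
  set L := (|A⁻¹| + |B⁻¹|) * (Kg + |k| / R * (|A| + |B|)) with hL
  have hL0 : 0 ≤ L := by positivity
  refine ⟨(1 + L).toNNReal, fun t ht => LipschitzOnWith.of_dist_le_mul fun x hx y hy => ?_⟩
  rw [Real.coe_toNNReal _ (by positivity)]
  have ht0 : 0 < t := hR.trans_le ht
  have d1 : |x.1 - y.1| ≤ dist x y := by
    rw [Prod.dist_eq, ← Real.dist_eq]; exact le_max_left _ _
  have d2 : |x.2 - y.2| ≤ dist x y := by
    rw [Prod.dist_eq, ← Real.dist_eq]; exact le_max_right _ _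
  have hx1 : x.1 ∈ Metric.closedBall z₀.1 a := by
    rw [Metric.mem_closedBall, Prod.dist_eq] at hx
    exact (le_max_left _ _).trans hx
  have hy1 : y.1 ∈ Metric.closedBall z₀.1 a := by
    rw [Metric.mem_closedBall, Prod.dist_eq] at hy
    exact (le_max_left _ _).trans hy
  have hgd : |g x.1 - g y.1| ≤ Kg * dist x y := by
    have := hKg.dist_le_mul _ hx1 _ hy1
    rw [Real.dist_eq, Real.dist_eq] at this
    exact this.trans (by gcongr)
  have hpd : |k / t * pucciFun A B x.2 - k / t * pucciFun A B y.2|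
      ≤ |k| / R * (|A| + |B|) * dist x y := by
    rw [← mul_sub, abs_mul, abs_div, abs_of_pos ht0, mul_assoc]
    have := abs_pucciFun_sub_le A B x.2 y.2
    gcongr
    exact this.trans (by gcongr)
  have key : |(pucciField A B k g t x).2 - (pucciField A B k g t y).2| ≤ L * dist x y := by
    simp only [pucciField]
    refine (abs_pucciFun_sub_le _ _ _ _).trans ?_
    rw [hL, mul_assoc]
    gcongr
    rw [show -g x.1 - k / t * pucciFun A B x.2 - (-g y.1 - k / t * pucciFun A B y.2)
      = -(g x.1 - g y.1) + -(k / t * pucciFun A B x.2 - k / t * pucciFun A B y.2) by ring]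
    refine (abs_add_le _ _).trans ?_
    rw [abs_neg, abs_neg, add_mul]
    exact add_le_add hgd hpd
  have hd := dist_nonneg (x := x) (y := y)
  have hLd := mul_nonneg hL0 hd
  rw [Prod.dist_eq (x := pucciField A B k g t x), Real.dist_eq, Real.dist_eq]
  refine max_le ?_ ?_
  · simp only [pucciField]; linarith
  · linarith

theorem exists_local_solution_pucciField (hg : LocallyLipschitz g) {R : ℝ} (hR : 0 < R)
    (z₀ : ℝ × ℝ) : ∃ ε > 0, ∃ Z : ℝ → ℝ × ℝ, Z R = z₀ ∧
      ∀ t ∈ Icc R (R + ε), HasDerivWithinAt Z (pucciField A B k g t (Z t)) (Icc R (R + ε)) t := by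
  obtain ⟨K, hK⟩ := exists_lipschitzOnWith_pucciField (A := A) (B := B) (k := k) hg hR z₀ 1
  have hcont := continuousOn_pucciField (A := A) (B := B) (k := k) hg.continuous
  obtain ⟨C, hC⟩ := (isCompact_Icc (a := R) (b := R + 1)).prod (isCompact_closedBall z₀ 1)
    |>.exists_bound_of_continuousOn (hcont.mono fun q hq => hR.trans_le hq.1.1)
  set ε := min 1 (1 / (|C| + 1)) with hε
  have hε0 : 0 < ε := by positivity
  have hεC : |C| * ε ≤ 1 := by
    have h1 : ε ≤ 1 / (|C| + 1) := min_le_right _ _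
    rw [le_div_iff₀ (by positivity)] at h1
    linarith
  have hPL : IsPicardLindelof (pucciField A B k g) (tmin := R) (tmax := R + ε)
      ⟨R, le_rfl, by linarith⟩ z₀ 1 0 |C|.toNNReal K := by
    refine ⟨fun t ht => by simpa using hK t ht.1, fun x hx => ?_, fun t ht x hx => ?_, ?_⟩
    · exact hcont.comp (f := fun t => (t, x)) (by fun_prop) fun t ht => hR.trans_le ht.1
    · rw [Real.coe_toNNReal _ (abs_nonneg _)]
      refine (hC (t, x) ⟨⟨ht.1, ht.2.trans ?_⟩, by simpa using hx⟩).trans (le_abs_self _)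
      linarith [min_le_left 1 (1 / (|C| + 1))]
    · simpa [hε0.le] using hεC
  obtain ⟨Z, h0, h⟩ := hPL.exists_eq_forall_mem_Icc_hasDerivWithinAt₀
  exact ⟨ε, hε0, Z, h0, h⟩

/-- A solution of the radial equation whose value and derivative converge at `R` extends
beyond `R`. -/
theorem radial_pucci_extend (hA : 0 < A) (hB : 0 < B) (hg : LocallyLipschitz g) {R : ℝ}
    (hR : 0 < R) {v v₁ v₂ : ℝ → ℝ} {l₀ l₁ : ℝ}
    (hv : ∀ r ∈ Ioo 0 R, HasDerivAt v (v₁ r) r) (hv₁ : ∀ r ∈ Ioo 0 R, HasDerivAt v₁ (v₂ r) r)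
    (hode : ∀ r ∈ Ioo 0 R, pucciFun A B (v₂ r) + k / r * pucciFun A B (v₁ r) + g (v r) = 0)
    (hl₀ : Tendsto v (𝓝[<] R) (𝓝 l₀)) (hl₁ : Tendsto v₁ (𝓝[<] R) (𝓝 l₁)) :
    ∃ ε > 0, ∃ w w₁ w₂ : ℝ → ℝ, (∀ r < R, w r = v r) ∧ ∀ r ∈ Ioo 0 (R + ε),
      HasDerivAt w (w₁ r) r ∧ HasDerivAt w₁ (w₂ r) r ∧ ContinuousAt w₂ r ∧
      pucciFun A B (w₂ r) + k / r * pucciFun A B (w₁ r) + g (w r) = 0 := by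
  obtain ⟨ε, hε, Y, hY0, hY⟩ := exists_local_solution_pucciField (A := A) (B := B) (k := k)
    hg hR (l₀, l₁)
  have hcont := continuousOn_pucciField (A := A) (B := B) (k := k) hg.continuous
  have hopen : IsOpen {q : ℝ × ℝ × ℝ | 0 < q.1} := isOpen_lt continuous_const continuous_fst
  set Z : ℝ → ℝ × ℝ := fun r => if r < R then (v r, v₁ r) else Y r with hZ
  have hZl : ∀ r < R, Z r = (v r, v₁ r) := fun r hr => by simp [hZ, hr]
  have hZr : ∀ r, R ≤ r → Z r = Y r := fun r hr => by simp [hZ, not_lt.2 hr]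
  have hZR : Z R = (l₀, l₁) := by rw [hZr R le_rfl, hY0]
  have hleft : ∀ r ∈ Ioo 0 R, HasDerivAt Z (pucciField A B k g r (Z r)) r := by
    intro r hr
    rw [hZl r hr.2, pucciField_eq hA hB (hode r hr)]
    refine ((hv r hr).prodMk (hv₁ r hr)).congr_of_eventuallyEq ?_
    filter_upwards [Iio_mem_nhds hr.2] with s hs using hZl s hs
  have hZlim : Tendsto Z (𝓝[<] R) (𝓝 (Z R)) := by
    rw [hZR]
    refine (hl₀.prodMk_nhds hl₁).congr' ?_
    filter_upwards [self_mem_nhdsWithin] with s hs using (hZl s hs).symm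
  have hmem : Ioo 0 R ∈ 𝓝[<] R := Ioo_mem_nhdsLT hR
  have hderivL : HasDerivWithinAt Z (pucciField A B k g R (Z R)) (Iic R) R := by
    refine hasDerivWithinAt_Iic_of_tendsto_deriv
      (fun r hr => (hleft r hr).differentiableAt.differentiableWithinAt)
      (hZlim.mono_left (nhdsWithin_mono _ Ioo_subset_Iio_self)) hmem ?_
    have h1 : Tendsto (fun r => ((r, Z r) : ℝ × ℝ × ℝ)) (𝓝[<] R) (𝓝 (R, Z R)) :=
      (tendsto_nhdsWithin_of_tendsto_nhds tendsto_id).prodMk_nhds hZlim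
    refine (((hcont.continuousAt (hopen.mem_nhds hR)).tendsto).comp h1).congr' ?_
    filter_upwards [hmem] with r hr using (hleft r hr).deriv.symm
  have hderivR : HasDerivWithinAt Z (pucciField A B k g R (Z R)) (Ici R) R := by
    rw [hZr R le_rfl]
    have h1 := (hY R ⟨le_rfl, by linarith⟩).mono_of_mem_nhdsWithin
      (s := Ici R) (Icc_mem_nhdsGE (lt_add_of_pos_right R hε))
    exact h1.congr (fun s hs => hZr s hs) (hZr R le_rfl)
  have hder : ∀ r ∈ Ioo 0 (R + ε), HasDerivAt Z (pucciField A B k g r (Z r)) r := by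
    intro r hr
    rcases lt_trichotomy r R with h | rfl | h
    · exact hleft r ⟨hr.1, h⟩
    · have := hderivL.union hderivR
      rwa [Iic_union_Ici, hasDerivWithinAt_univ] at this
    · rw [hZr r h.le]
      refine ((hY r ⟨h.le, hr.2.le⟩).hasDerivAt (Icc_mem_nhds h hr.2)).congr_of_eventuallyEq ?_
      filter_upwards [Ioi_mem_nhds h] with s hs using hZr s (le_of_lt hs)
  refine ⟨ε, hε, fun r => (Z r).1, fun r => (Z r).2, fun r => (pucciField A B k g r (Z r)).2,
    fun r hr => by simp [hZl r hr], fun r hr => ⟨?_, ?_, ?_, pucciField_solves hA hB _ _⟩⟩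
  · exact (hder r hr).fst
  · exact (hder r hr).snd
  · have h1 : ContinuousAt (fun s => ((s, Z s) : ℝ × ℝ × ℝ)) r :=
      continuousAt_id.prodMk (hder r hr).continuousAt
    have h2 := hcont.continuousAt (x := (r, Z r)) (hopen.mem_nhds hr.1)
    exact (ContinuousAt.comp (f := fun s => ((s, Z s) : ℝ × ℝ × ℝ)) h2 h1).snd

end Extension

/-- On a bounded range beyond `α`, a continuous `g` which is negative there stays away from `0`. -/
theorem exists_growth_constants {A k α a M : ℝ} {g : ℝ → ℝ} (hk : 0 < k) (hA : 0 < A)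
    (hg : Continuous g) (hneg : ∀ t, α < t → g t < 0) (ha : α < a) (haM : a ≤ M) :
    ∃ c δ : ℝ, 0 < δ ∧ (1 + k) * A * δ < c ∧ ∀ t ∈ Icc a M, g t ≤ -c := by
  obtain ⟨t₀, ht₀, hmax⟩ := isCompact_Icc.exists_isMaxOn (nonempty_Icc.2 haM) hg.continuousOn
  have h0 := hneg t₀ (ha.trans_le ht₀.1)
  have hpos : 0 < (1 + k) * A := by positivity
  refine ⟨-g t₀, -g t₀ / (2 * ((1 + k) * A)), ?_, ?_, fun t ht => ?_⟩
  · exact div_pos (by linarith) (by positivity)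
  · rw [mul_div_assoc', div_lt_iff₀ (by positivity)]
    nlinarith
  · simpa using hmax ht

section Key

variable {A B k α : ℝ} {g v v₁ v₂ : ℝ → ℝ} {R : EReal}

theorem radial_pucci_bounded_growth {M : ℝ} (hk : 0 < k) (hA : 0 < A) (hB : 0 < B)
    (hg : Continuous g) (hneg : ∀ t, α < t → g t < 0) (hξ : α < v 0) (hR : 0 < R)
    (hv : ∀ r ∈ {r : ℝ | 0 ≤ r ∧ (r : EReal) < R},
      HasDerivWithinAt v (v₁ r) {r : ℝ | 0 ≤ r ∧ (r : EReal) < R} r)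
    (hv₁ : ∀ r ∈ {r : ℝ | 0 ≤ r ∧ (r : EReal) < R},
      HasDerivWithinAt v₁ (v₂ r) {r : ℝ | 0 ≤ r ∧ (r : EReal) < R} r)
    (hv₂ : ContinuousOn v₂ {r : ℝ | 0 ≤ r ∧ (r : EReal) < R})
    (hode : ∀ r : ℝ, 0 < r → (r : EReal) < R →
      pucciFun A B (v₂ r) + k / r * pucciFun A B (v₁ r) + g (v r) = 0)
    {T : EReal} (hM : ∀ r : ℝ, 0 ≤ r → (r : EReal) ≤ T → (r : EReal) < R → v r ≤ M) :
    ∃ δ > 0, ∀ r : ℝ, 0 < r → (r : EReal) ≤ T → (r : EReal) < R → v 0 ≤ v r ∧ δ * r ≤ v₁ r := by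
  by_cases hT : 0 < T
  swap
  · exact ⟨1, one_pos, fun r h1 h2 => absurd ((EReal.coe_pos.2 h1).trans_le h2) hT⟩
  obtain ⟨c, δ, hδ, hδc, hc⟩ := exists_growth_constants hk hA hg hneg hξ
    (hM 0 le_rfl (by simpa using hT.le) (by simpa using hR))
  refine ⟨δ, hδ, fun r h0 hrT hrR => ?_⟩
  have hsub : Icc 0 r ⊆ {r : ℝ | 0 ≤ r ∧ (r : EReal) < R} := fun s hs =>
    ⟨hs.1, (EReal.coe_le_coe_iff.2 hs.2).trans_lt hrR⟩
  exact radial_pucci_linear_growth h0 hk hA hB hg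
    (fun s hs => (hv s (hsub hs)).mono hsub) (fun s hs => (hv₁ s (hsub hs)).mono hsub)
    (hv₂.mono hsub) (fun s hs => hode s hs.1 (hsub (Ioc_subset_Icc_self hs)).2) hδ hδc
    (fun s hs => hM s hs.1 ((EReal.coe_le_coe_iff.2 hs.2).trans hrT) (hsub hs).2) hc r ⟨h0.le, le_rfl⟩
/-- Solutions starting above `α` are strictly increasing and, unless they extend, unbounded. -/
theorem radial_pucci_key (hk : 0 < k) (hA : 0 < A) (hB : 0 < B)
    (hg : LocallyLipschitz g) (hneg : ∀ t, α < t → g t < 0) (hξ : α < v 0) (hR : 0 < R)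
    (hv : ∀ r ∈ {r : ℝ | 0 ≤ r ∧ (r : EReal) < R},
      HasDerivWithinAt v (v₁ r) {r : ℝ | 0 ≤ r ∧ (r : EReal) < R} r)
    (hv₁ : ∀ r ∈ {r : ℝ | 0 ≤ r ∧ (r : EReal) < R},
      HasDerivWithinAt v₁ (v₂ r) {r : ℝ | 0 ≤ r ∧ (r : EReal) < R} r)
    (hv₂ : ContinuousOn v₂ {r : ℝ | 0 ≤ r ∧ (r : EReal) < R})
    (hode : ∀ r : ℝ, 0 < r → (r : EReal) < R →
      pucciFun A B (v₂ r) + k / r * pucciFun A B (v₁ r) + g (v r) = 0)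
    (hmax : ∀ R₀ : ℝ, R = R₀ → ¬ ∃ ε > 0, ∃ w w₁ w₂ : ℝ → ℝ, (∀ r < R₀, w r = v r) ∧
      ∀ r ∈ Ioo 0 (R₀ + ε), HasDerivAt w (w₁ r) r ∧ HasDerivAt w₁ (w₂ r) r ∧ ContinuousAt w₂ r ∧
        pucciFun A B (w₂ r) + k / r * pucciFun A B (w₁ r) + g (w r) = 0) :
    StrictMonoOn v {r : ℝ | 0 ≤ r ∧ (r : EReal) < R} ∧
      ∀ M, ∃ r ∈ {r : ℝ | 0 ≤ r ∧ (r : EReal) < R}, M < v r := by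
  set S := {r : ℝ | 0 ≤ r ∧ (r : EReal) < R} with hS
  have hdown : ∀ {s r : ℝ}, 0 ≤ s → s ≤ r → (r : EReal) < R → s ∈ S := fun h0 hsr hr =>
    ⟨h0, (EReal.coe_le_coe_iff.2 hsr).trans_lt hr⟩
  have h0S : (0 : ℝ) ∈ S := ⟨le_rfl, by simpa using hR⟩
  have hconv : Convex ℝ S := by
    refine Set.OrdConnected.convex ⟨fun x hx y hy z hz => ?_⟩
    exact hdown (hx.1.trans hz.1) hz.2 hy.2
  have hint : ∀ r ∈ interior S, 0 < r := fun r hr => by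
    have := interior_mono (show S ⊆ Ici 0 from fun s hs => hs.1) hr
    rwa [interior_Ici] at this
  have cv : ContinuousOn v S := fun r hr => (hv r hr).continuousWithinAt
  have cv₁ : ContinuousOn v₁ S := fun r hr => (hv₁ r hr).continuousWithinAt
  have hpos : ∀ r : ℝ, 0 < r → (r : EReal) < R → v 0 ≤ v r ∧ 0 < v₁ r := by
    intro r h0 hr
    obtain ⟨M, hM⟩ := isCompact_Icc.exists_bound_of_continuousOn
      (cv.mono (show Icc 0 r ⊆ S from fun s hs => hdown hs.1 hs.2 hr))
    obtain ⟨δ, hδ, h⟩ := radial_pucci_bounded_growth hk hA hB hg.continuous hneg hξ hR hv hv₁ hv₂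
      hode (T := r) (M := M)
      fun s h0 hs _ => (le_abs_self _).trans (hM s ⟨h0, EReal.coe_le_coe_iff.1 hs⟩)
    have := h r h0 le_rfl hr
    exact ⟨this.1, (mul_pos hδ h0).trans_le this.2⟩
  have hmono : StrictMonoOn v S :=
    strictMonoOn_of_hasDerivWithinAt_pos hconv cv
      (fun r hr => (hv r (interior_subset hr)).mono interior_subset)
      fun r hr => (hpos r (hint r hr) (interior_subset hr).2).2
  refine ⟨hmono, ?_⟩
  by_contra! hbdd
  obtain ⟨M, hM⟩ := hbdd
  obtain ⟨δ, hδ, hgrow⟩ := radial_pucci_bounded_growth hk hA hB hg.continuous hneg hξ hR hv hv₁ hv₂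
      hode (T := ⊤) (M := M) fun s h0 _ hs => hM s ⟨h0, hs⟩
  have hM0 : v 0 ≤ M := hM 0 h0S
  induction R with
  | bot => simp at hR
  | top =>
    have hm : MonotoneOn (fun r => v r - δ / 2 * r ^ 2) S := by
      refine monotoneOn_of_hasDerivWithinAt_nonneg hconv (cv.sub (by fun_prop))
        (f' := fun r => v₁ r - δ / 2 * (2 * r)) (fun r hr => ?_) fun r hr => ?_
      · have h2 : HasDerivAt (fun r : ℝ => δ / 2 * r ^ 2) (δ / 2 * (2 * r)) r := by
          simpa using (hasDerivAt_pow 2 r).const_mul (δ / 2)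
        exact ((hv r (interior_subset hr)).mono interior_subset).sub h2.hasDerivWithinAt
      · have := (hgrow r (hint r hr) le_top (interior_subset hr).2).2
        linarith
    set r := 1 + 2 * (M - v 0) / δ with hr
    have hq : 0 ≤ 2 * (M - v 0) / δ := div_nonneg (by linarith) hδ.le
    have hr1 : 1 ≤ r := by linarith
    have hrS : r ∈ S := ⟨by linarith, EReal.coe_lt_top r⟩
    have h1 := hm h0S hrS hrS.1
    have h2 := hM r hrS
    have h3 : δ / 2 * r = δ / 2 + (M - v 0) := by rw [hr]; field_simp
    have h4 : δ / 2 * r ≤ δ / 2 * r ^ 2 := by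
      gcongr
      nlinarith
    simp only at h1
    linarith
  | coe R₀ =>
    have hR0 : 0 < R₀ := by simpa using hR
    have hIS : Ioo 0 R₀ ⊆ S := fun r hr => ⟨hr.1.le, EReal.coe_lt_coe_iff.2 hr.2⟩
    have hnhds : ∀ r ∈ Ioo 0 R₀, S ∈ 𝓝 r := fun r hr => mem_of_superset (Ioo_mem_nhds hr.1 hr.2) hIS
    have dv : ∀ r ∈ Ioo 0 R₀, HasDerivAt v (v₁ r) r := fun r hr =>
      (hv r (hIS hr)).hasDerivAt (hnhds r hr)
    have dv₁ : ∀ r ∈ Ioo 0 R₀, HasDerivAt v₁ (v₂ r) r := fun r hr =>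
      (hv₁ r (hIS hr)).hasDerivAt (hnhds r hr)
    obtain ⟨K, hK⟩ := (isCompact_Icc (a := v 0) (b := M)).exists_bound_of_continuousOn
      hg.continuous.continuousOn
    have hK0 : 0 ≤ K := (norm_nonneg _).trans (hK (v 0) ⟨le_rfl, hM0⟩)
    have hv₂le : ∀ r ∈ Ioo 0 R₀, v₂ r ≤ K / A := by
      intro r hr
      obtain ⟨h1, h2⟩ := hpos r hr.1 (hIS hr).2
      rcases le_or_gt (v₂ r) 0 with h | h
      · exact h.trans (by positivity)
      · have e := hode r hr.1 (hIS hr).2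
        rw [pucciFun_of_nonneg h.le, pucciFun_of_nonneg h2.le] at e
        have h3 : 0 ≤ k / r * (A * v₁ r) := by
          have := hr.1
          positivity
        have h4 := neg_le_of_abs_le (hK (v r) ⟨h1, hM r (hIS hr)⟩)
        rw [le_div_iff₀ hA]
        linarith
    have hl₀ := (hmono.monotoneOn.mono hIS).tendsto_nhdsWithin_Ioo_left (nonempty_Ioo.2 hR0)
      ⟨M, by rintro _ ⟨r, hr, rfl⟩; exact hM r (hIS hr)⟩
    have hm₁ : MonotoneOn (fun r => K / A * r - v₁ r) (Ioo 0 R₀) := by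
      refine monotoneOn_of_hasDerivWithinAt_nonneg (convex_Ioo _ _)
        (ContinuousOn.sub (by fun_prop) (cv₁.mono hIS))
        (f' := fun r => K / A * 1 - v₂ r) (fun r hr => ?_) fun r hr => ?_
      · exact (((hasDerivAt_id r).const_mul (K / A)).sub
          (dv₁ r (interior_subset hr))).hasDerivWithinAt
      · have := hv₂le r (interior_subset hr)
        linarith
    have hl := hm₁.tendsto_nhdsWithin_Ioo_left (nonempty_Ioo.2 hR0)
      ⟨K / A * R₀, by
        rintro _ ⟨r, hr, rfl⟩
        have h1 := (hpos r hr.1 (hIS hr).2).2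
        have h2 : K / A * r ≤ K / A * R₀ := by
          have := hr.2.le
          gcongr
        simp only
        linarith⟩
    have hlin : Tendsto (fun r : ℝ => K / A * r) (𝓝[<] R₀) (𝓝 (K / A * R₀)) :=
      tendsto_nhdsWithin_of_tendsto_nhds ((continuous_const.mul continuous_id).tendsto R₀)
    have hl₁ := hlin.sub hl
    simp only [sub_sub_cancel] at hl₁
    exact hmax R₀ rfl (radial_pucci_extend hA hB hg hR0 dv dv₁
      (fun r hr => hode r hr.1 (hIS hr).2) hl₀ hl₁)

end Key

section Reduction

variable {A B k : ℝ} {g u : ℝ → ℝ} {R : EReal}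

/-- A classical extension beyond a finite endpoint contradicts maximality. -/
theorem radial_pucci_not_extend {ξ R₀ : ℝ} (hR₀ : 0 < R₀)
    (hu : ContDiffOn ℝ 2 u {r : ℝ | 0 ≤ r ∧ (r : EReal) < R₀})
    (hu0 : u 0 = ξ) (hu'0 : deriv u 0 = 0)
    (hmax : ¬ ∃ (R' : EReal) (v : ℝ → ℝ), (R₀ : EReal) < R' ∧
      ContDiffOn ℝ 2 v {r : ℝ | 0 ≤ r ∧ (r : EReal) < R'} ∧
      (∀ r : ℝ, 0 < r → (r : EReal) < R' →
        pucciFun A B (deriv (deriv v) r) + k / r * pucciFun A B (deriv v r) + g (v r) = 0) ∧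
      v 0 = ξ ∧ deriv v 0 = 0 ∧
      (∀ r : ℝ, 0 ≤ r → (r : EReal) < R₀ → v r = u r)) :
    ¬ ∃ ε > 0, ∃ w w₁ w₂ : ℝ → ℝ, (∀ r < R₀, w r = u r) ∧
      ∀ r ∈ Ioo 0 (R₀ + ε), HasDerivAt w (w₁ r) r ∧ HasDerivAt w₁ (w₂ r) r ∧ ContinuousAt w₂ r ∧
        pucciFun A B (w₂ r) + k / r * pucciFun A B (w₁ r) + g (w r) = 0 := by
  rintro ⟨ε, hε, w, w₁, w₂, hwu, hw⟩
  have hd : EqOn (deriv w) w₁ (Ioo 0 (R₀ + ε)) := fun r hr => (hw r hr).1.deriv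
  have hdd : EqOn (deriv (deriv w)) w₂ (Ioo 0 (R₀ + ε)) := fun r hr => by
    rw [(hd.eventuallyEq_of_mem (isOpen_Ioo.mem_nhds hr)).deriv_eq]
    exact (hw r hr).2.1.deriv
  have hC : ContDiffOn ℝ 2 w (Ioo 0 (R₀ + ε)) := by
    rw [show (2 : WithTop ℕ∞) = 1 + 1 by norm_num, contDiffOn_succ_iff_deriv_of_isOpen isOpen_Ioo]
    refine ⟨fun r hr => (hw r hr).1.differentiableAt.differentiableWithinAt, by simp, ?_⟩
    refine ContDiffOn.congr ?_ hd
    rw [show (1 : WithTop ℕ∞) = 0 + 1 by norm_num, contDiffOn_succ_iff_deriv_of_isOpen isOpen_Ioo]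
    refine ⟨fun r hr => (hw r hr).2.1.differentiableAt.differentiableWithinAt, by simp, ?_⟩
    rw [contDiffOn_zero]
    exact fun r hr => (((hw r hr).2.2.1.continuousWithinAt).congr
      (fun s hs => (hw s hs).2.1.deriv) (hw r hr).2.1.deriv)
  have hev : ∀ r < R₀, w =ᶠ[𝓝 r] u := fun r hr => by
    filter_upwards [Iio_mem_nhds hr] with s hs using hwu s hs
  refine hmax ⟨((R₀ + ε : ℝ) : EReal), w, EReal.coe_lt_coe_iff.2 (by linarith), ?_, ?_,
    (hwu 0 hR₀).trans hu0, (hev 0 hR₀).deriv_eq.trans hu'0,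
    fun r _ hr => hwu r (EReal.coe_lt_coe_iff.1 hr)⟩
  · rintro r ⟨hr0, hr⟩
    have hr' := EReal.coe_lt_coe_iff.1 hr
    rcases lt_or_ge r R₀ with h | h
    · have h1 := (hu r ⟨hr0, EReal.coe_lt_coe_iff.2 h⟩).congr_of_eventuallyEq
        ((hev r h).filter_mono nhdsWithin_le_nhds) (hwu r h)
      refine h1.mono_of_mem_nhdsWithin ?_
      filter_upwards [self_mem_nhdsWithin, mem_nhdsWithin_of_mem_nhds (Iio_mem_nhds h)]
        with s hs hs' using ⟨hs.1, EReal.coe_lt_coe_iff.2 hs'⟩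
    · exact (hC.contDiffAt (Ioo_mem_nhds (hR₀.trans_le h) hr')).contDiffWithinAt
  · intro r h0 hr
    have hrI : r ∈ Ioo 0 (R₀ + ε) := ⟨h0, EReal.coe_lt_coe_iff.1 hr⟩
    rw [hdd hrI, hd hrI]
    exact (hw r hrI).2.2.2

theorem exists_hasDerivWithinAt_of_contDiffOn_two (hR : 0 < R)
    (hu : ContDiffOn ℝ 2 u {r : ℝ | 0 ≤ r ∧ (r : EReal) < R}) :
    ∃ u₁ u₂ : ℝ → ℝ,
      (∀ r ∈ {r : ℝ | 0 ≤ r ∧ (r : EReal) < R},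
        HasDerivWithinAt u (u₁ r) {r : ℝ | 0 ≤ r ∧ (r : EReal) < R} r) ∧
      (∀ r ∈ {r : ℝ | 0 ≤ r ∧ (r : EReal) < R},
        HasDerivWithinAt u₁ (u₂ r) {r : ℝ | 0 ≤ r ∧ (r : EReal) < R} r) ∧
      ContinuousOn u₂ {r : ℝ | 0 ≤ r ∧ (r : EReal) < R} ∧
      ∀ r : ℝ, 0 < r → (r : EReal) < R → deriv u r = u₁ r ∧ deriv (deriv u) r = u₂ r := by
  set S := {r : ℝ | 0 ≤ r ∧ (r : EReal) < R} with hS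
  have hopen : IsOpen {r : ℝ | 0 < r ∧ (r : EReal) < R} :=
    (isOpen_lt continuous_const continuous_id).inter
      (isOpen_lt continuous_coe_real_ereal continuous_const)
  have hnhds : ∀ r : ℝ, 0 < r → (r : EReal) < R → S ∈ 𝓝 r := fun r h0 hr =>
    mem_of_superset (hopen.mem_nhds ⟨h0, hr⟩) fun s hs => ⟨hs.1.le, hs.2⟩
  have hconv : Convex ℝ S := by
    refine Set.OrdConnected.convex ⟨fun x hx y hy z hz => ?_⟩
    exact ⟨hx.1.trans hz.1, (EReal.coe_le_coe_iff.2 hz.2).trans_lt hy.2⟩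
  have huniq : UniqueDiffOn ℝ S := by
    obtain ⟨t, h0, ht⟩ := EReal.lt_iff_exists_real_btwn.1 hR
    exact uniqueDiffOn_convex hconv
      ⟨t, mem_interior_iff_mem_nhds.2 (hnhds t (EReal.coe_pos.1 h0) ht)⟩
  rw [show (2 : WithTop ℕ∞) = 1 + 1 by norm_num, contDiffOn_succ_iff_derivWithin huniq] at hu
  obtain ⟨hd, -, hu⟩ := hu
  rw [show (1 : WithTop ℕ∞) = 0 + 1 by norm_num, contDiffOn_succ_iff_derivWithin huniq] at hu
  obtain ⟨hd₁, -, hu⟩ := hu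
  refine ⟨derivWithin u S, derivWithin (derivWithin u S) S, fun r hr => (hd r hr).hasDerivWithinAt,
    fun r hr => (hd₁ r hr).hasDerivWithinAt, contDiffOn_zero.1 hu, fun r h0 hr => ?_⟩
  have heq : ∀ s : ℝ, 0 < s → (s : EReal) < R → deriv u s = derivWithin u S s := fun s h0 hs =>
    (derivWithin_of_mem_nhds (hnhds s h0 hs)).symm
  refine ⟨heq r h0 hr, ?_⟩
  rw [derivWithin_of_mem_nhds (hnhds r h0 hr)]
  refine Filter.EventuallyEq.deriv_eq ?_
  filter_upwards [hopen.mem_nhds ⟨h0, hr⟩] with s hs using heq s hs.1 hs.2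

theorem tendsto_atTop_of_strictMonoOn_of_unbounded {v : ℝ → ℝ}
    (hmono : StrictMonoOn v {r : ℝ | 0 ≤ r ∧ (r : EReal) < R})
    (hunb : ∀ M, ∃ r ∈ {r : ℝ | 0 ≤ r ∧ (r : EReal) < R}, M < v r) :
    Tendsto v (comap (fun r : ℝ => (r : EReal)) (𝓝[<] R)) atTop := by
  refine tendsto_atTop.2 fun M => ?_
  obtain ⟨r, hr, hM⟩ := hunb M
  refine mem_comap.2 ⟨Ioo (r : EReal) R, Ioo_mem_nhdsLT hr.2, fun s hs => ?_⟩
  have hrs : r < s := EReal.coe_lt_coe_iff.1 hs.1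
  exact hM.le.trans (hmono hr ⟨hr.1.trans hrs.le, hs.2⟩ hrs).le

end Reduction

open Set Filter Topology

theorem pucci_radial_plus_large_data
    (lam Lam : ℝ) (hlam : 0 < lam) (hlamLam : lam ≤ Lam)
    (N : ℕ) (hN : 2 ≤ N)
    (g : ℝ → ℝ) (hg1 : LocallyLipschitz g)
    (hg2 : ∀ t, g (-t) = - g t)
    (α : ℝ) (hα : 0 < α)
    (hg3pos : ∀ t, 0 < t → t < α → 0 < g t)
    (hg3neg : ∀ t, α < t → g t < 0)
    (g'0 : ℝ) (hg4 : HasDerivAt g g'0 0) (hg4pos : 0 < g'0)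
    (ξ : ℝ) (hξ : α < |ξ|)
    (R : EReal) (hR : 0 < R)
    (u : ℝ → ℝ)
    (hu : ContDiffOn ℝ 2 u {r : ℝ | 0 ≤ r ∧ (r : EReal) < R})
    (hode : ∀ r : ℝ, 0 < r → (r : EReal) < R →
      (if 0 ≤ deriv (deriv u) r then Lam else lam) * deriv (deriv u) r
        + ((N : ℝ) - 1) / r * ((if 0 ≤ deriv u r then Lam else lam) * deriv u r)
        + g (u r) = 0)
    (hu0 : u 0 = ξ) (hu'0 : deriv u 0 = 0)
    (hmax : ¬ ∃ (R' : EReal) (v : ℝ → ℝ), R < R' ∧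
      ContDiffOn ℝ 2 v {r : ℝ | 0 ≤ r ∧ (r : EReal) < R'} ∧
      (∀ r : ℝ, 0 < r → (r : EReal) < R' →
        (if 0 ≤ deriv (deriv v) r then Lam else lam) * deriv (deriv v) r
        + ((N : ℝ) - 1) / r * ((if 0 ≤ deriv v r then Lam else lam) * deriv v r)
        + g (v r) = 0) ∧
      v 0 = ξ ∧ deriv v 0 = 0 ∧
      (∀ r : ℝ, 0 ≤ r → (r : EReal) < R → v r = u r))
 :
    StrictMonoOn (fun r => |u r|) {r : ℝ | 0 < r ∧ (r : EReal) < R} ∧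
    Tendsto (fun r => |u r|)
      (comap (fun r : ℝ => (r : EReal)) (𝓝[<] R)) atTop := by
  have hLam : 0 < Lam := hlam.trans_le hlamLam
  have hk : 0 < (N : ℝ) - 1 := by
    have : (2 : ℝ) ≤ N := by exact_mod_cast hN
    linarith
  set S := {r : ℝ | 0 ≤ r ∧ (r : EReal) < R} with hS
  have h0S : (0 : ℝ) ∈ S := ⟨le_rfl, by simpa using hR⟩
  obtain ⟨u₁, u₂, hd, hd₁, hc₂, hderiv⟩ := exists_hasDerivWithinAt_of_contDiffOn_two hR hu
  have hode' : ∀ r : ℝ, 0 < r → (r : EReal) < R →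
      pucciFun Lam lam (u₂ r) + ((N : ℝ) - 1) / r * pucciFun Lam lam (u₁ r) + g (u r) = 0 := by
    intro r h0 hr
    have := hode r h0 hr
    rwa [(hderiv r h0 hr).1, (hderiv r h0 hr).2] at this
  have hext : ∀ R₀ : ℝ, R = R₀ → ¬ ∃ ε > 0, ∃ w w₁ w₂ : ℝ → ℝ, (∀ r < R₀, w r = u r) ∧
      ∀ r ∈ Ioo 0 (R₀ + ε), HasDerivAt w (w₁ r) r ∧ HasDerivAt w₁ (w₂ r) r ∧ ContinuousAt w₂ r ∧
        pucciFun Lam lam (w₂ r) + ((N : ℝ) - 1) / r * pucciFun Lam lam (w₁ r) + g (w r) = 0 := by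
    rintro R₀ rfl
    exact radial_pucci_not_extend (EReal.coe_pos.1 hR) hu hu0 hu'0 hmax
  suffices h : ∃ v : ℝ → ℝ, (∀ r, |v r| = |u r|) ∧ 0 < v 0 ∧ StrictMonoOn v S ∧
      ∀ M, ∃ r ∈ S, M < v r by
    obtain ⟨v, hvu, hv0, hmono, hunb⟩ := h
    have habs : ∀ r ∈ S, |u r| = v r := fun r hr => by
      rw [← hvu, abs_of_pos (hv0.trans_le (hmono.monotoneOn h0S hr hr.1))]
    have habs_mono : StrictMonoOn (fun r => |u r|) S := hmono.congr fun r hr => (habs r hr).symm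
    refine ⟨habs_mono.mono fun r hr => ⟨hr.1.le, hr.2⟩,
      tendsto_atTop_of_strictMonoOn_of_unbounded habs_mono fun M => ?_⟩
    obtain ⟨r, hr, hM⟩ := hunb M
    exact ⟨r, hr, by simpa only [habs r hr] using hM⟩
  rcases le_or_gt 0 ξ with hξ0 | hξ0
  · rw [abs_of_nonneg hξ0, ← hu0] at hξ
    exact ⟨u, fun _ => rfl, hα.trans hξ,
      radial_pucci_key hk hLam hlam hg1 hg3neg hξ hR hd hd₁ hc₂ hode' hext⟩
  · rw [abs_of_neg hξ0, ← hu0] at hξ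
    refine ⟨fun r => -u r, fun _ => abs_neg _, hα.trans hξ, ?_⟩
    refine radial_pucci_key (v₁ := fun r => -u₁ r) (v₂ := fun r => -u₂ r) hk hlam hLam hg1 hg3neg
      hξ hR (fun r hr => (hd r hr).neg) (fun r hr => (hd₁ r hr).neg) hc₂.neg
      (fun r h0 hr => ?_) fun R₀ hR₀ => ?_
    · rw [pucciFun_neg, pucciFun_neg, hg2]
      linarith [hode' r h0 hr]
    · rintro ⟨ε, hε, w, w₁, w₂, hwu, hw⟩
      refine hext R₀ hR₀ ⟨ε, hε, fun r => -w r, fun r => -w₁ r, fun r => -w₂ r,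
        fun r hr => by simp [hwu r hr], fun r hr => ?_⟩
      obtain ⟨h1, h2, h3, h4⟩ := hw r hr
      refine ⟨h1.neg, h2.neg, h3.neg, ?_⟩
      rw [pucciFun_neg, pucciFun_neg, hg2]
      linarith
end
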